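/- arXiv:2602.01295 — 3 statements merged into one kernel-verified Lean document; each statement's English description precedes it below -/
import Mathlib

section
/- Expected stability contribution of the shifted loss: with η_t = β/(σ t^{1/α}) for some β > 0, and π̊ any deterministic policy, 𝔼[ η_t ∑_{(s,a)} x(s,a)^{2 − 1/α} (ℓ̃^{shift}(s,a))² ] ≤ 8 H² β C^{2−α} · σ t^{1/α − 1} · ∑_{(s,a): a ≠ π̊(s)} x(s,a)^{1/α}, where the expectation is over both the random trajectory and the random losses. -/
open Finset MeasureTheory

open scoped Classical

/-- The loss that is `1` at the pair `(s₀, a₀)` and `0` elsewhere; its values are conditional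
occupancy measures of `(s₀, a₀)`. -/
noncomputable def pairIndicator {S A : Type*} (s₀ : S) (a₀ : A) (s : S) (a : A) : ℝ :=
  if s = s₀ ∧ a = a₀ then 1 else 0

theorem layer_backward_induction {S : Type*} {H : ℕ} {layer : S → ℕ} (hle : ∀ s, layer s ≤ H)
    {p : S → Prop} (step : ∀ s, (∀ s', layer s' = layer s + 1 → p s') → p s) (s : S) : p s := by
  suffices h : ∀ n, ∀ s, H - layer s = n → p s from h _ s rfl
  intro n
  induction n with
  | zero =>
    intro s hs
    refine step s fun s' hs' => ?_
    have := hle s'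
    omega
  | succ n ih =>
    intro s hs
    exact step s fun s' hs' => ih s' (by omega)

theorem sum_transition_le_one {S A : Type*} [Fintype S] {H : ℕ} {layer : S → ℕ}
    {P : S → A → S → ℝ}
    (hle : ∀ s, layer s ≤ H)
    (hP_supp : ∀ s a s', P s a s' ≠ 0 → layer s' = layer s + 1)
    (hP_sum : ∀ s a, layer s < H → ∑ s', P s a s' = 1) (s : S) (a : A) :
    ∑ s', P s a s' ≤ 1 := by
  rcases lt_or_ge (layer s) H with h | h
  · exact (hP_sum s a h).le
  · refine (Finset.sum_eq_zero fun s' _ => ?_).trans_le zero_le_one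
    by_contra h0
    have := hP_supp s a s' h0
    have := hle s'
    omega

section Bellman

variable {S A : Type*} [Fintype S] [Fintype A] {H : ℕ} {layer : S → ℕ}
  {P : S → A → S → ℝ} {π : S → A → ℝ}
  {Q : (S → A → ℝ) → S → A → ℝ} {V : (S → A → ℝ) → S → ℝ}

theorem sum_mul_pairIndicator (f : S → A → ℝ) (s : S) (a : A) :
    ∑ s', ∑ a', f s' a' * pairIndicator s' a' s a = f s a := by
  rw [Finset.sum_eq_single s, Finset.sum_eq_single a]
  · simp [pairIndicator]
  · intro b _ hb
    simp [pairIndicator, Ne.symm hb]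
  · simp
  · intro b _ hb
    simp [pairIndicator, Ne.symm hb]
  · simp

theorem sum_pairIndicator_mul (f : S → A → ℝ) (s₀ : S) (a₀ : A) :
    ∑ s, ∑ a, f s a * pairIndicator s₀ a₀ s a = f s₀ a₀ := by
  rw [Finset.sum_eq_single s₀, Finset.sum_eq_single a₀]
  · simp [pairIndicator]
  · intro b _ hb
    simp [pairIndicator, hb]
  · simp
  · intro b _ hb
    simp [pairIndicator, hb]
  · simp

/-- Values are linear in the loss. -/
theorem value_eq_sum_pairIndicator
    (hle : ∀ s, layer s ≤ H)
    (hP_supp : ∀ s a s', P s a s' ≠ 0 → layer s' = layer s + 1)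
    (hQ : ∀ ℓ s a, Q ℓ s a = ℓ s a + ∑ s', P s a s' * V ℓ s')
    (hV : ∀ ℓ s, V ℓ s = ∑ a, π s a * Q ℓ s a) (ℓ : S → A → ℝ) (s : S) :
    (∀ a, Q ℓ s a = ∑ s', ∑ a', ℓ s' a' * Q (pairIndicator s' a') s a) ∧
      V ℓ s = ∑ s', ∑ a', ℓ s' a' * V (pairIndicator s' a') s := by
  refine layer_backward_induction (p := fun s =>
    (∀ a, Q ℓ s a = ∑ s', ∑ a', ℓ s' a' * Q (pairIndicator s' a') s a) ∧
      V ℓ s = ∑ s', ∑ a', ℓ s' a' * V (pairIndicator s' a') s) hle (fun s ih => ?_) s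
  have hq : ∀ a, Q ℓ s a = ∑ s', ∑ a', ℓ s' a' * Q (pairIndicator s' a') s a := by
    intro a
    have h1 : ∀ s', P s a s' * V ℓ s' =
        P s a s' * ∑ s'', ∑ a', ℓ s'' a' * V (pairIndicator s'' a') s' := by
      intro s'
      by_cases h : P s a s' = 0
      · simp [h]
      · rw [← (ih s' (hP_supp s a s' h)).2]
    rw [hQ, Finset.sum_congr rfl fun s' _ => h1 s']
    simp_rw [hQ (pairIndicator _ _), mul_add, Finset.sum_add_distrib, sum_mul_pairIndicator,
      Finset.mul_sum]
    congr 1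
    rw [Finset.sum_comm]
    refine Finset.sum_congr rfl fun s'' _ => ?_
    rw [Finset.sum_comm]
    refine Finset.sum_congr rfl fun a' _ => Finset.sum_congr rfl fun s' _ => ?_
    ring
  refine ⟨hq, ?_⟩
  rw [hV]
  simp_rw [hV (pairIndicator _ _), hq, Finset.mul_sum]
  rw [Finset.sum_comm]
  refine Finset.sum_congr rfl fun s'' _ => ?_
  rw [Finset.sum_comm]
  refine Finset.sum_congr rfl fun a' _ => Finset.sum_congr rfl fun s' _ => ?_
  ring

theorem value_nonneg
    (hle : ∀ s, layer s ≤ H)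
    (hP_nonneg : ∀ s a s', 0 ≤ P s a s')
    (hP_supp : ∀ s a s', P s a s' ≠ 0 → layer s' = layer s + 1)
    (hπ_nonneg : ∀ s a, 0 ≤ π s a)
    (hQ : ∀ ℓ s a, Q ℓ s a = ℓ s a + ∑ s', P s a s' * V ℓ s')
    (hV : ∀ ℓ s, V ℓ s = ∑ a, π s a * Q ℓ s a) {ℓ : S → A → ℝ} (hℓ : ∀ s a, 0 ≤ ℓ s a) (s : S) :
    (∀ a, 0 ≤ Q ℓ s a) ∧ 0 ≤ V ℓ s := by
  refine layer_backward_induction (p := fun s => (∀ a, 0 ≤ Q ℓ s a) ∧ 0 ≤ V ℓ s) hle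
    (fun s ih => ?_) s
  have hq : ∀ a, 0 ≤ Q ℓ s a := by
    intro a
    rw [hQ]
    refine add_nonneg (hℓ s a) (Finset.sum_nonneg fun s' _ => ?_)
    by_cases h : P s a s' = 0
    · simp [h]
    · exact mul_nonneg (hP_nonneg _ _ _) (ih s' (hP_supp s a s' h)).2
  refine ⟨hq, ?_⟩
  rw [hV]
  exact Finset.sum_nonneg fun a _ => mul_nonneg (hπ_nonneg s a) (hq a)

theorem value_pairIndicator_le_one
    (hle : ∀ s, layer s ≤ H)
    (hP_nonneg : ∀ s a s', 0 ≤ P s a s')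
    (hP_supp : ∀ s a s', P s a s' ≠ 0 → layer s' = layer s + 1)
    (hP_sum : ∀ s a, layer s < H → ∑ s', P s a s' = 1)
    (hπ_nonneg : ∀ s a, 0 ≤ π s a) (hπ_sum : ∀ s, ∑ a, π s a = 1)
    (hQ : ∀ ℓ s a, Q ℓ s a = ℓ s a + ∑ s', P s a s' * V ℓ s')
    (hV : ∀ ℓ s, V ℓ s = ∑ a, π s a * Q ℓ s a) (s₀ : S) (a₀ : A) (s : S) :
    (∀ a, Q (pairIndicator s₀ a₀) s a ≤ 1) ∧ V (pairIndicator s₀ a₀) s ≤ 1 ∧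
      (layer s₀ < layer s → V (pairIndicator s₀ a₀) s = 0) := by
  refine layer_backward_induction (p := fun s => (∀ a, Q (pairIndicator s₀ a₀) s a ≤ 1) ∧
    V (pairIndicator s₀ a₀) s ≤ 1 ∧ (layer s₀ < layer s → V (pairIndicator s₀ a₀) s = 0)) hle
    (fun s ih => ?_) s
  have hzero : ∀ a, layer s₀ ≤ layer s →
      ∑ s', P s a s' * V (pairIndicator s₀ a₀) s' = 0 := by
    intro a h
    refine Finset.sum_eq_zero fun s' _ => ?_
    by_cases h0 : P s a s' = 0
    · simp [h0]
    · have hl := hP_supp s a s' h0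
      rw [(ih s' hl).2.2 (by omega), mul_zero]
  have hq : ∀ a, Q (pairIndicator s₀ a₀) s a ≤ 1 := by
    intro a
    rw [hQ]
    by_cases h : s = s₀ ∧ a = a₀
    · rw [hzero a (by rw [h.1])]
      simp [pairIndicator, h]
    · simp only [pairIndicator, h, if_false, zero_add]
      refine le_trans (Finset.sum_le_sum fun s' _ => ?_)
        (sum_transition_le_one hle hP_supp hP_sum s a)
      by_cases h0 : P s a s' = 0
      · simp [h0]
      · exact mul_le_of_le_one_right (hP_nonneg _ _ _) (ih s' (hP_supp s a s' h0)).2.1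
  refine ⟨hq, ?_, fun h => ?_⟩
  · rw [hV, ← hπ_sum s]
    exact Finset.sum_le_sum fun a _ => mul_le_of_le_one_right (hπ_nonneg s a) (hq a)
  · rw [hV]
    refine Finset.sum_eq_zero fun a _ => ?_
    have hs : s ≠ s₀ := by
      rintro rfl
      exact lt_irrefl _ h
    rw [hQ, hzero a h.le]
    simp [pairIndicator, hs]

theorem value_one_le
    (hle : ∀ s, layer s ≤ H)
    (hP_nonneg : ∀ s a s', 0 ≤ P s a s')
    (hP_supp : ∀ s a s', P s a s' ≠ 0 → layer s' = layer s + 1)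
    (hP_sum : ∀ s a, layer s < H → ∑ s', P s a s' = 1)
    (hπ_nonneg : ∀ s a, 0 ≤ π s a) (hπ_sum : ∀ s, ∑ a, π s a = 1)
    (hQ : ∀ ℓ s a, Q ℓ s a = ℓ s a + ∑ s', P s a s' * V ℓ s')
    (hV : ∀ ℓ s, V ℓ s = ∑ a, π s a * Q ℓ s a) (s : S) :
    (∀ a, Q (fun _ _ => 1) s a ≤ H + 1 - layer s) ∧
      V (fun _ _ => 1) s ≤ H + 1 - layer s := by
  refine layer_backward_induction (p := fun s => (∀ a, Q (fun _ _ => 1) s a ≤ H + 1 - layer s) ∧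
    V (fun _ _ => 1) s ≤ H + 1 - layer s) hle (fun s ih => ?_) s
  have hs : (layer s : ℝ) ≤ H := by exact_mod_cast hle s
  have hq : ∀ a, Q (fun _ _ => 1) s a ≤ H + 1 - layer s := by
    intro a
    have h1 : ∑ s', P s a s' * V (fun _ _ => 1) s' ≤ ∑ s', P s a s' * (H - layer s) := by
      refine Finset.sum_le_sum fun s' _ => ?_
      by_cases h0 : P s a s' = 0
      · simp [h0]
      · have hl := hP_supp s a s' h0
        have h2 := (ih s' hl).2
        rw [hl] at h2
        push_cast at h2
        exact mul_le_mul_of_nonneg_left (by linarith) (hP_nonneg _ _ _)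
    rw [← Finset.sum_mul] at h1
    have h3 := mul_le_of_le_one_left (sub_nonneg.2 hs)
      (sum_transition_le_one hle hP_supp hP_sum s a)
    rw [hQ]
    linarith
  refine ⟨hq, ?_⟩
  rw [hV]
  calc ∑ a, π s a * Q (fun _ _ => 1) s a ≤ ∑ a, π s a * (H + 1 - layer s) :=
        Finset.sum_le_sum fun a _ => mul_le_mul_of_nonneg_left (hq a) (hπ_nonneg s a)
    _ = H + 1 - layer s := by rw [← Finset.sum_mul, hπ_sum, one_mul]

theorem occupancy_eq_policy_mul {s₁ : S} (hs₁ : ∀ s, layer s = 1 ↔ s = s₁)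
    (hlayer : ∀ s, 1 ≤ layer s) (hπ_sum : ∀ s, ∑ a, π s a = 1) {x : S → A → ℝ}
    (hx_init : ∀ a, x s₁ a = π s₁ a)
    (hx_rec : ∀ s' a', 2 ≤ layer s' → x s' a' = π s' a' * ∑ s, ∑ a, P s a s' * x s a)
    (s : S) (a : A) : x s a = π s a * ∑ b, x s b := by
  by_cases h : s = s₁
  · subst h
    simp_rw [hx_init, hπ_sum, mul_one]
  · have h2 : 2 ≤ layer s := by
      have := hlayer s
      have := mt (hs₁ s).1 h
      omega
    simp_rw [hx_rec s _ h2, ← Finset.sum_mul, hπ_sum, one_mul]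

/-- The expected loss collected from layer `h` on. -/
theorem sum_layer_occupancy_mul_value
    (hle : ∀ s, layer s ≤ H)
    (hP_supp : ∀ s a s', P s a s' ≠ 0 → layer s' = layer s + 1)
    (hπ_sum : ∀ s, ∑ a, π s a = 1) {x : S → A → ℝ}
    (hx_rec : ∀ s' a', 2 ≤ layer s' → x s' a' = π s' a' * ∑ s, ∑ a, P s a s' * x s a)
    (hx_pol : ∀ s a, x s a = π s a * ∑ b, x s b)
    (hQ : ∀ ℓ s a, Q ℓ s a = ℓ s a + ∑ s', P s a s' * V ℓ s')
    (hV : ∀ ℓ s, V ℓ s = ∑ a, π s a * Q ℓ s a) (ℓ : S → A → ℝ) (h : ℕ) (hh : 1 ≤ h) :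
    ∑ s with layer s = h, (∑ b, x s b) * V ℓ s = ∑ s with h ≤ layer s, ∑ a, x s a * ℓ s a := by
  suffices key : ∀ n h : ℕ, 1 ≤ h → H + 1 - h = n →
      ∑ s with layer s = h, (∑ b, x s b) * V ℓ s =
        ∑ s with h ≤ layer s, ∑ a, x s a * ℓ s a from key _ h hh rfl
  intro n
  induction n with
  | zero =>
    intro h _ hn
    rw [Finset.filter_false_of_mem, Finset.filter_false_of_mem]
    · simp
    · intro s _
      have := hle s
      omega
    · intro s _
      have := hle s
      omega
  | succ n ih =>
    intro h h1 hn
    have hmass : ∀ s', 2 ≤ layer s' → ∑ b, x s' b = ∑ s, ∑ a, P s a s' * x s a := by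
      intro s' h2
      simp_rw [hx_rec s' _ h2, ← Finset.sum_mul, hπ_sum, one_mul]
    have hval : ∀ s, (∑ b, x s b) * V ℓ s =
        ∑ a, x s a * ℓ s a + ∑ a, x s a * ∑ s', P s a s' * V ℓ s' := by
      intro s
      rw [hV, Finset.mul_sum, ← Finset.sum_add_distrib]
      refine Finset.sum_congr rfl fun a _ => ?_
      rw [hQ, ← mul_assoc, mul_comm (∑ b, x s b), ← hx_pol, mul_add]
    have hnext : ∑ s with layer s = h, ∑ a, x s a * ∑ s', P s a s' * V ℓ s' =
        ∑ s' with layer s' = h + 1, (∑ b, x s' b) * V ℓ s' := by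
      have e1 : ∀ s', layer s' = h + 1 → (∑ b, x s' b) =
          ∑ s with layer s = h, ∑ a, P s a s' * x s a := by
        intro s' hs'
        rw [hmass s' (by omega), Finset.sum_filter]
        refine Finset.sum_congr rfl fun s _ => ?_
        split_ifs with hs
        · rfl
        · refine Finset.sum_eq_zero fun a _ => ?_
          by_cases h0 : P s a s' = 0
          · simp [h0]
          · have := hP_supp s a s' h0
            omega
      symm
      rw [Finset.sum_congr rfl fun s' hs' => by
        rw [e1 s' (Finset.mem_filter.1 hs').2]]
      simp_rw [Finset.sum_mul]
      rw [Finset.sum_comm]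
      refine Finset.sum_congr rfl fun s hs => ?_
      rw [Finset.sum_comm]
      refine Finset.sum_congr rfl fun a _ => ?_
      rw [Finset.mul_sum, Finset.sum_filter]
      refine Finset.sum_congr rfl fun s' _ => ?_
      split_ifs with hs'
      · ring
      · have h0 : P s a s' = 0 := by
          by_contra h0
          have h3 := hP_supp s a s' h0
          rw [(Finset.mem_filter.1 hs).2] at h3
          exact hs' h3
        simp [h0]
    rw [Finset.sum_congr rfl fun s _ => hval s, Finset.sum_add_distrib, hnext,
      ih (h + 1) (by omega) (by omega), ← Finset.sum_union]
    · refine Finset.sum_congr ?_ fun _ _ => rfl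
      ext s
      simp only [Finset.mem_union, Finset.mem_filter, Finset.mem_univ, true_and]
      omega
    · refine Finset.disjoint_filter.2 fun s _ hs => ?_
      omega

theorem mass_mul_value_pairIndicator_le
    (hlayer : ∀ s, 1 ≤ layer s) (hle : ∀ s, layer s ≤ H)
    (hP_supp : ∀ s a s', P s a s' ≠ 0 → layer s' = layer s + 1)
    (hP_nonneg : ∀ s a s', 0 ≤ P s a s')
    (hπ_nonneg : ∀ s a, 0 ≤ π s a)
    (hπ_sum : ∀ s, ∑ a, π s a = 1) {x : S → A → ℝ} (hx : ∀ s a, 0 ≤ x s a)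
    (hx_rec : ∀ s' a', 2 ≤ layer s' → x s' a' = π s' a' * ∑ s, ∑ a, P s a s' * x s a)
    (hx_pol : ∀ s a, x s a = π s a * ∑ b, x s b)
    (hQ : ∀ ℓ s a, Q ℓ s a = ℓ s a + ∑ s', P s a s' * V ℓ s')
    (hV : ∀ ℓ s, V ℓ s = ∑ a, π s a * Q ℓ s a) (s₀ : S) (a₀ : A) (s : S) :
    (∑ b, x s b) * V (pairIndicator s₀ a₀) s ≤ x s₀ a₀ := by
  have hδ : ∀ s a, (0 : ℝ) ≤ pairIndicator s₀ a₀ s a := by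
    intro s a
    unfold pairIndicator
    split_ifs <;> simp
  have hv := fun s => (value_nonneg hle hP_nonneg hP_supp hπ_nonneg hQ hV hδ s).2
  calc (∑ b, x s b) * V (pairIndicator s₀ a₀) s
      ≤ ∑ s' with layer s' = layer s, (∑ b, x s' b) * V (pairIndicator s₀ a₀) s' :=
        Finset.single_le_sum
          (f := fun s' => (∑ b, x s' b) * V (pairIndicator s₀ a₀) s')
          (fun s' _ => mul_nonneg (Finset.sum_nonneg fun b _ => hx s' b) (hv s')) (by simp)
    _ = ∑ s' with layer s ≤ layer s', ∑ a, x s' a * pairIndicator s₀ a₀ s' a :=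
        sum_layer_occupancy_mul_value hle hP_supp hπ_sum hx_rec hx_pol hQ hV _ _ (hlayer s)
    _ ≤ ∑ s', ∑ a, x s' a * pairIndicator s₀ a₀ s' a :=
        Finset.sum_le_sum_of_subset_of_nonneg (Finset.subset_univ _) fun s' _ _ =>
          Finset.sum_nonneg fun a _ => mul_nonneg (hx s' a) (hδ s' a)
    _ = x s₀ a₀ := sum_pairIndicator_mul x s₀ a₀

/-- The coefficients of the shifted loss at `(s, a)` as a linear functional of the loss. -/
theorem shift_coefficient_bounds
    (hlayer : ∀ s, 1 ≤ layer s) (hle : ∀ s, layer s ≤ H)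
    (hP_nonneg : ∀ s a s', 0 ≤ P s a s')
    (hP_supp : ∀ s a s', P s a s' ≠ 0 → layer s' = layer s + 1)
    (hP_sum : ∀ s a, layer s < H → ∑ s', P s a s' = 1)
    (hπ_nonneg : ∀ s a, 0 ≤ π s a) (hπ_sum : ∀ s, ∑ a, π s a = 1)
    {x : S → A → ℝ} (hx : ∀ s a, 0 ≤ x s a)
    (hx_rec : ∀ s' a', 2 ≤ layer s' → x s' a' = π s' a' * ∑ s, ∑ a, P s a s' * x s a)
    (hx_pol : ∀ s a, x s a = π s a * ∑ b, x s b)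
    (hQ : ∀ ℓ s a, Q ℓ s a = ℓ s a + ∑ s', P s a s' * V ℓ s')
    (hV : ∀ ℓ s, V ℓ s = ∑ a, π s a * Q ℓ s a) (s : S) (a : A) :
    (∀ s' a', |Q (pairIndicator s' a') s a - V (pairIndicator s' a') s| ≤ 1 ∧
      x s a * |Q (pairIndicator s' a') s a - V (pairIndicator s' a') s| ≤ x s' a') ∧
    ∑ s', ∑ a', |Q (pairIndicator s' a') s a - V (pairIndicator s' a') s| ≤
      2 * H * (1 - π s a) := by
  have hδ : ∀ s₀ a₀ s a, (0 : ℝ) ≤ pairIndicator (S := S) (A := A) s₀ a₀ s a := by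
    intro s₀ a₀ s a
    unfold pairIndicator
    split_ifs <;> simp
  have hq0 := fun s' a' =>
    (value_nonneg hle hP_nonneg hP_supp hπ_nonneg hQ hV (hδ s' a') s).1
  have hv0 := fun s' a' =>
    (value_nonneg hle hP_nonneg hP_supp hπ_nonneg hQ hV (hδ s' a') s).2
  have hle1 := fun s' a' =>
    value_pairIndicator_le_one hle hP_nonneg hP_supp hP_sum hπ_nonneg hπ_sum hQ hV s' a' s
  have hmass := fun s' a' => mass_mul_value_pairIndicator_le hlayer hle hP_supp hP_nonneg
    hπ_nonneg hπ_sum hx hx_rec hx_pol hQ hV s' a' s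
  have hterm : ∀ ℓ, (∀ a, 0 ≤ Q ℓ s a) → π s a * Q ℓ s a ≤ V ℓ s := by
    intro ℓ hℓ
    rw [hV]
    exact Finset.single_le_sum (f := fun b => π s b * Q ℓ s b)
      (fun b _ => mul_nonneg (hπ_nonneg s b) (hℓ b)) (Finset.mem_univ a)
  have hπ1 : π s a ≤ 1 :=
    hπ_sum s ▸ Finset.single_le_sum (fun b _ => hπ_nonneg s b) (Finset.mem_univ a)
  have hX : 0 ≤ ∑ b, x s b := Finset.sum_nonneg fun b _ => hx s b
  have hxX : x s a ≤ ∑ b, x s b :=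
    Finset.single_le_sum (fun b _ => hx s b) (Finset.mem_univ a)
  refine ⟨fun s' a' => ⟨?_, ?_⟩, ?_⟩
  · rw [abs_le]
    constructor <;> linarith [hq0 s' a' a, hv0 s' a', (hle1 s' a').1 a, (hle1 s' a').2.1]
  · have h1 : x s a * Q (pairIndicator s' a') s a ≤ x s' a' := by
      rw [hx_pol]
      calc π s a * (∑ b, x s b) * Q (pairIndicator s' a') s a
          = (∑ b, x s b) * (π s a * Q (pairIndicator s' a') s a) := by ring
        _ ≤ (∑ b, x s b) * V (pairIndicator s' a') s := by
          gcongr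
          exact hterm _ (hq0 s' a')
        _ ≤ x s' a' := hmass s' a'
    have h2 : x s a * V (pairIndicator s' a') s ≤ x s' a' :=
      (mul_le_mul_of_nonneg_right hxX (hv0 s' a')).trans (hmass s' a')
    have habs : x s a * |Q (pairIndicator s' a') s a - V (pairIndicator s' a') s| =
        |x s a * (Q (pairIndicator s' a') s a - V (pairIndicator s' a') s)| := by
      rw [abs_mul, abs_of_nonneg (hx s a)]
    rw [habs, abs_le, mul_sub]
    have h3 := mul_nonneg (hx s a) (hq0 s' a' a)
    have h4 := mul_nonneg (hx s a) (hv0 s' a')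
    constructor <;> linarith
  · have habs : ∀ s' a', |Q (pairIndicator s' a') s a - V (pairIndicator s' a') s| ≤
        (1 - 2 * π s a) * Q (pairIndicator s' a') s a + V (pairIndicator s' a') s := by
      intro s' a'
      have h1 := hterm _ (hq0 s' a')
      have h2 := mul_nonneg (sub_nonneg.2 hπ1) (hq0 s' a' a)
      rw [abs_le]
      constructor <;> linarith
    have h1 := value_eq_sum_pairIndicator hle hP_supp hQ hV (fun _ _ => 1) s
    simp only [one_mul] at h1
    have hone := value_one_le hle hP_nonneg hP_supp hP_sum hπ_nonneg hπ_sum hQ hV s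
    have hl : (1 : ℝ) ≤ layer s := by exact_mod_cast hlayer s
    have hoff : V (fun _ _ => 1) s - π s a * Q (fun _ _ => 1) s a ≤ (1 - π s a) * H := by
      have hsub : 1 - π s a = ∑ b ∈ Finset.univ.erase a, π s b := by
        rw [← hπ_sum s, ← Finset.add_sum_erase _ _ (Finset.mem_univ a), add_sub_cancel_left]
      rw [hV, ← Finset.add_sum_erase _ _ (Finset.mem_univ a), add_sub_cancel_left, hsub,
        Finset.sum_mul]
      exact Finset.sum_le_sum fun b _ =>
        mul_le_mul_of_nonneg_left (by linarith [hone.1 b]) (hπ_nonneg s b)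
    have hon : (1 - π s a) * Q (fun _ _ => 1) s a ≤ (1 - π s a) * H :=
      mul_le_mul_of_nonneg_left (by linarith [hone.1 a]) (sub_nonneg.2 hπ1)
    calc ∑ s', ∑ a', |Q (pairIndicator s' a') s a - V (pairIndicator s' a') s|
        ≤ ∑ s', ∑ a', ((1 - 2 * π s a) * Q (pairIndicator s' a') s a +
            V (pairIndicator s' a') s) :=
          Finset.sum_le_sum fun s' _ => Finset.sum_le_sum fun a' _ => habs s' a'
      _ = (1 - 2 * π s a) * Q (fun _ _ => 1) s a + V (fun _ _ => 1) s := by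
          simp_rw [Finset.sum_add_distrib, ← Finset.mul_sum]
          rw [← h1.1 a, ← h1.2]
      _ ≤ 2 * H * (1 - π s a) := by linarith

end Bellman

theorem sum_mul_integral_sum {Ω E ι : Type*} [Fintype Ω] [Fintype ι] [MeasurableSpace E]
    (p : Ω → ℝ) (μ : Ω → Measure E) (w : ι → ℝ) (f : Ω → ι → E → ℝ)
    (hf : ∀ T i, Integrable (f T i) (μ T)) :
    ∑ T, p T * ∫ e, ∑ i, w i * f T i e ∂(μ T) = ∑ i, w i * ∑ T, p T * ∫ e, f T i e ∂(μ T) := by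
  have h : ∀ T, ∫ e, ∑ i, w i * f T i e ∂(μ T) = ∑ i, w i * ∫ e, f T i e ∂(μ T) := by
    intro T
    rw [integral_finsetSum _ fun i _ => (hf T i).const_mul _]
    simp_rw [integral_const_mul]
  simp_rw [h, Finset.mul_sum]
  rw [Finset.sum_comm]
  refine Finset.sum_congr rfl fun i _ => Finset.sum_congr rfl fun T _ => ?_
  ring

/-- A weight dominated by the occupancy measure `y` up to the factor `c` keeps the heavy-tailed
second moment under control. -/
theorem sq_mul_rpow_neg_le {u c y γ : ℝ} (hc : 0 < c) (hγ0 : 0 ≤ γ) (hγ1 : γ ≤ 1)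
    (hu1 : |u| ≤ 1) (huy : c * |u| ≤ y) : u ^ 2 * y ^ (-γ) ≤ c ^ (-γ) * |u| := by
  rcases eq_or_ne u 0 with rfl | hu
  · simp
  have hu0 : 0 < |u| := abs_pos.2 hu
  have h1 : y ^ (-γ) ≤ (c * |u|) ^ (-γ) :=
    Real.rpow_le_rpow_of_nonpos (mul_pos hc hu0) huy (by linarith)
  have h2 : u ^ 2 * |u| ^ (-γ) ≤ |u| := by
    have h3 : u ^ 2 * |u| ^ (-γ) = |u| ^ (2 - γ) := by
      rw [← sq_abs, ← Real.rpow_natCast, ← Real.rpow_add hu0]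
      norm_num [sub_eq_add_neg]
    rw [h3]
    calc |u| ^ (2 - γ) ≤ |u| ^ (1 : ℝ) :=
          Real.rpow_le_rpow_of_exponent_ge hu0 hu1 (by linarith)
      _ = |u| := Real.rpow_one _
  calc u ^ 2 * y ^ (-γ) ≤ u ^ 2 * (c * |u|) ^ (-γ) := by gcongr
    _ = c ^ (-γ) * (u ^ 2 * |u| ^ (-γ)) := by
        rw [Real.mul_rpow hc.le hu0.le]
        ring
    _ ≤ c ^ (-γ) * |u| := by gcongr

/-- Cauchy–Schwarz for a family supported on the range of a map from `Fin H`. -/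
theorem sq_sum_le_card_mul_of_support {ι : Type*} [Fintype ι] {H : ℕ} (T : Fin H → ι) (f : ι → ℝ)
    (hf : ∀ i, (¬ ∃ h, T h = i) → f i = 0) : (∑ i, f i) ^ 2 ≤ H * ∑ i, f i ^ 2 := by
  have h1 : ∑ i, f i = ∑ i ∈ Finset.univ.image T, f i := by
    refine (Finset.sum_subset (Finset.subset_univ _) fun i _ hi => hf i ?_).symm
    simpa using hi
  have hcard : ((Finset.univ.image T).card : ℝ) ≤ H := by
    have h := Finset.card_image_le (s := Finset.univ) (f := T)
    rw [Finset.card_univ, Fintype.card_fin] at h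
    exact_mod_cast h
  calc (∑ i, f i) ^ 2 ≤ (Finset.univ.image T).card * ∑ i ∈ Finset.univ.image T, f i ^ 2 := by
        rw [h1]
        exact sq_sum_le_card_mul_sum_sq
    _ ≤ H * ∑ i, f i ^ 2 := by
        exact mul_le_mul hcard (Finset.sum_le_sum_of_subset_of_nonneg (Finset.subset_univ _)
          fun _ _ _ => sq_nonneg _) (Finset.sum_nonneg fun _ _ => sq_nonneg _) (Nat.cast_nonneg H)

theorem measurable_truncation (τ : ℝ) : Measurable fun z : ℝ => if |z| ≤ τ then z else 0 :=
  Measurable.ite (measurableSet_le measurable_id.abs measurable_const) measurable_id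
    measurable_const

theorem abs_truncation_le {τ : ℝ} (hτ : 0 ≤ τ) (z : ℝ) : |if |z| ≤ τ then z else 0| ≤ τ := by
  split_ifs with h
  · exact h
  · simpa using hτ

theorem integrable_truncation_sq {τ : ℝ} (hτ : 0 ≤ τ) (ν : Measure ℝ) [IsFiniteMeasure ν] :
    Integrable (fun z : ℝ => (if |z| ≤ τ then z else 0) ^ 2) ν := by
  refine Integrable.of_bound ((measurable_truncation τ).pow_const 2).aestronglyMeasurable (τ ^ 2)
    (Filter.Eventually.of_forall fun z => ?_)
  rw [norm_pow, Real.norm_eq_abs]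
  gcongr
  exact abs_truncation_le hτ z

theorem integral_truncation_sq_le {τ α m : ℝ} (hτ : 0 ≤ τ) (hα2 : α ≤ 2)
    {ν : Measure ℝ} (hint : Integrable (fun z : ℝ => |z| ^ α) ν) (hm : ∫ z, |z| ^ α ∂ν ≤ m) :
    ∫ z, (if |z| ≤ τ then z else 0) ^ 2 ∂ν ≤ τ ^ (2 - α) * m := by
  calc ∫ z, (if |z| ≤ τ then z else 0) ^ 2 ∂ν ≤ ∫ z, τ ^ (2 - α) * |z| ^ α ∂ν := by
        refine integral_mono_of_nonneg (Filter.Eventually.of_forall fun z => sq_nonneg _)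
          (hint.const_mul _) (Filter.Eventually.of_forall fun z => ?_)
        have hnn : 0 ≤ τ ^ (2 - α) * |z| ^ α := by positivity
        dsimp only
        split_ifs with h
        · rcases eq_or_ne z 0 with rfl | hz
          · simpa using hnn
          · have hz0 : 0 < |z| := abs_pos.2 hz
            have e : z ^ 2 = |z| ^ (2 - α) * |z| ^ α := by
              rw [← Real.rpow_add hz0, ← sq_abs, ← Real.rpow_natCast]
              norm_num
            rw [e]
            gcongr
        · simpa using hnn
    _ = τ ^ (2 - α) * ∫ z, |z| ^ α ∂ν := integral_const_mul _ _
    _ ≤ τ ^ (2 - α) * m := by gcongr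

theorem threshold_rpow_mul_eq {σ C t α y : ℝ} (hσ : 0 < σ) (hC : 0 < C) (ht : 0 < t) (hy : 0 < y)
    (hα : 0 < α) :
    (C * σ * t ^ (1 / α) * y ^ (1 / α)) ^ (2 - α) * σ ^ α * y⁻¹ =
      σ ^ 2 * C ^ (2 - α) * t ^ (2 / α - 1) * y ^ (-(2 - 2 / α)) := by
  rw [Real.mul_rpow (by positivity) (by positivity), Real.mul_rpow (by positivity) (by positivity),
    Real.mul_rpow hC.le hσ.le, ← Real.rpow_mul ht.le, ← Real.rpow_mul hy.le]
  have e1 : 1 / α * (2 - α) = 2 / α - 1 := by field_simp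
  have e2 : σ ^ 2 = σ ^ (2 - α) * σ ^ α := by
    rw [← Real.rpow_add hσ, ← Real.rpow_natCast]
    norm_num
  have e3 : y ^ (-(2 - 2 / α)) = y ^ (2 / α - 1) * y⁻¹ := by
    rw [← Real.rpow_neg_one, ← Real.rpow_add hy]
    congr 1
    ring
  rw [e1, e2, e3]
  ring

/-- The self-bounding step: the mass off one action controls the whole sum. -/
theorem sum_rpow_mul_one_sub_le {A : Type*} [Fintype A] {q : A → ℝ} (hq : ∀ a, 0 ≤ q a)
    (hq1 : ∑ a, q a = 1) {X r : ℝ} (hX : 0 ≤ X) (hr0 : 0 ≤ r) (hr1 : r ≤ 1) (a₀ : A) :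
    ∑ a, (q a * X) ^ r * (1 - q a) ≤ 2 * ∑ a with a ≠ a₀, (q a * X) ^ r := by
  have hle : ∀ a, q a ≤ 1 := fun a =>
    hq1 ▸ Finset.single_le_sum (fun b _ => hq b) (Finset.mem_univ a)
  have hne : Finset.univ.filter (fun a => a ≠ a₀) = Finset.univ.erase a₀ := by
    ext
    simp
  rw [hne, ← Finset.add_sum_erase _ _ (Finset.mem_univ a₀), two_mul]
  refine add_le_add ?_ (Finset.sum_le_sum fun a _ => ?_)
  · have h1 : 1 - q a₀ = ∑ a ∈ Finset.univ.erase a₀, q a := by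
      rw [← hq1, ← Finset.add_sum_erase _ _ (Finset.mem_univ a₀)]
      ring
    rw [h1, Finset.mul_sum]
    refine Finset.sum_le_sum fun a _ => ?_
    rw [Real.mul_rpow (hq _) hX, Real.mul_rpow (hq _) hX]
    have h2 : q a ≤ q a ^ r := by
      rcases (hq a).eq_or_lt with h | h
      · rw [← h]
        exact Real.rpow_nonneg le_rfl _
      · simpa using Real.rpow_le_rpow_of_exponent_ge h (hle a) hr1
    have h3 : q a₀ ^ r ≤ 1 := Real.rpow_le_one (hq _) (hle _) hr0
    have hXr := Real.rpow_nonneg hX r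
    have hqa := hq a
    calc q a₀ ^ r * X ^ r * q a ≤ 1 * X ^ r * q a ^ r := by gcongr
      _ = q a ^ r * X ^ r := by ring
  · exact mul_le_of_le_one_right (Real.rpow_nonneg (mul_nonneg (hq a) hX) _) (by linarith [hq a])

theorem stmt_13
    {S A : Type*} [Fintype S] [Fintype A] [Nonempty S] [Nonempty A]
    [DecidableEq S] [DecidableEq A]
    (H : ℕ) (hH : 1 ≤ H)
    (layer : S → ℕ)
    (hlayer : ∀ s : S, 1 ≤ layer s ∧ layer s ≤ H)
    (hlayer_ne : ∀ h : ℕ, 1 ≤ h → h ≤ H → ∃ s : S, layer s = h)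
    (s1 : S) (hs1 : ∀ s : S, (layer s = 1 ↔ s = s1))
    (P : S → A → S → ℝ)
    (hP_nonneg : ∀ s a s', 0 ≤ P s a s')
    (hP_supp : ∀ s a s', P s a s' ≠ 0 → layer s' = layer s + 1)
    (hP_sum : ∀ s a, layer s < H → ∑ s', P s a s' = 1)
    (π : S → A → ℝ)
    (hπ_nonneg : ∀ s a, 0 ≤ π s a)
    (hπ_sum : ∀ s, ∑ a, π s a = 1)
    (x : S → A → ℝ)
    (hx_init : ∀ a, x s1 a = π s1 a)
    (hx_rec : ∀ s' a', 2 ≤ layer s' → x s' a' = π s' a' * ∑ s, ∑ a, P s a s' * x s a)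
    (hx_pos : ∀ s a, 0 < x s a)
    (Q : (S → A → ℝ) → S → A → ℝ) (V : (S → A → ℝ) → S → ℝ)
    (hQ : ∀ ℓ s a, Q ℓ s a = ℓ s a + ∑ s', P s a s' * V ℓ s')
    (hV : ∀ ℓ s, V ℓ s = ∑ a, π s a * Q ℓ s a)
    (α σ C t : ℝ)
    (hα1 : 1 < α) (hα2 : α ≤ 2) (hσ : 0 < σ) (hC : 0 < C) (ht : 1 ≤ t)
    (β : ℝ) (hβ : 0 < β)
    (πd : S → A)
    (p : (Fin H → S × A) → ℝ)
    (hp_nonneg : ∀ T, 0 ≤ p T)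
    (hp_sum : ∑ T : Fin H → S × A, p T = 1)
    (hp_layer : ∀ T, p T ≠ 0 → ∀ h : Fin H, layer (T h).1 = (h : ℕ) + 1)
    (hp_marg : ∀ s a,
      (∑ T ∈ Finset.univ.filter (fun T : Fin H → S × A => ∃ h, T h = (s, a)), p T) = x s a)
    (ν : (Fin H → S × A) → S × A → Measure ℝ)
    (hν_prob : ∀ T sa, IsProbabilityMeasure (ν T sa))
    (hν_int : ∀ T sa, p T ≠ 0 → Integrable (fun z : ℝ => |z| ^ α) (ν T sa))
    (hν_mom : ∀ T sa, p T ≠ 0 → (∫ z : ℝ, |z| ^ α ∂(ν T sa)) ≤ σ ^ α)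
    (ℓskip : (Fin H → S × A) → ((S × A) → ℝ) → S → A → ℝ)
    (hℓskip : ∀ T L s a, ℓskip T L s a =
      (if ∃ h : Fin H, T h = (s, a) then
        (if |L (s, a)| ≤ C * σ * t ^ (1/α) * x s a ^ (1/α) then L (s, a) else 0) / x s a
      else 0))
    :
    (∑ T : Fin H → S × A, p T *
      (∫ (L : (S × A) → ℝ),
        (β / (σ * t ^ (1/α))) *
          ∑ s, ∑ a, x s a ^ (2 - 1/α) * (Q (ℓskip T L) s a - V (ℓskip T L) s) ^ 2
        ∂(Measure.pi fun sa => ν T sa)))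
    ≤ 8 * (H : ℝ) ^ 2 * β * C ^ (2 - α) * σ * t ^ (1/α - 1) *
        ∑ s, ∑ a ∈ Finset.univ.filter (fun a => a ≠ πd s), x s a ^ (1/α) := by
  have hle : ∀ s, layer s ≤ H := fun s => (hlayer s).2
  have hge : ∀ s, 1 ≤ layer s := fun s => (hlayer s).1
  have hα0 : 0 < α := by linarith
  have ht0 : 0 < t := by linarith
  have hx0 : ∀ s a, 0 ≤ x s a := fun s a => (hx_pos s a).le
  have hx_pol := occupancy_eq_policy_mul hs1 hge hπ_sum hx_init hx_rec
  have hlin := value_eq_sum_pairIndicator hle hP_supp hQ hV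
  have hcoef := shift_coefficient_bounds hge hle hP_nonneg hP_supp hP_sum hπ_nonneg hπ_sum hx0
    hx_rec hx_pol hQ hV
  obtain ⟨γ, hγ⟩ : ∃ γ : ℝ, γ = 2 - 2 / α := ⟨_, rfl⟩
  have hγ0 : 0 ≤ γ := by
    have : 2 / α ≤ 2 := by
      rw [div_le_iff₀ hα0]
      linarith
    linarith
  have hγ1 : γ ≤ 1 := by
    have : 1 ≤ 2 / α := by
      rw [le_div_iff₀ hα0]
      linarith
    linarith
  obtain ⟨K, hK⟩ : ∃ K : ℝ, K = σ ^ 2 * C ^ (2 - α) * t ^ (2 / α - 1) := ⟨_, rfl⟩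
  have hK0 : 0 ≤ K := by
    rw [hK]
    positivity
  obtain ⟨c, hc⟩ : ∃ c : ℝ, c = β / (σ * t ^ (1 / α)) := ⟨_, rfl⟩
  have hc0 : 0 ≤ c := by
    rw [hc]
    positivity
  have hτ : ∀ s a, 0 ≤ C * σ * t ^ (1 / α) * x s a ^ (1 / α) := by
    intro s a
    have := hx0 s a
    positivity
  have hsq : ∀ T L s a, ℓskip T L s a ^ 2 = (if ∃ h, T h = (s, a) then (1 : ℝ) else 0) *
      ((x s a ^ 2)⁻¹ *
        (if |L (s, a)| ≤ C * σ * t ^ (1 / α) * x s a ^ (1 / α) then L (s, a) else 0) ^ 2) := by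
    intro T L s a
    rw [hℓskip]
    split_ifs with h1 h2
    · rw [div_pow]
      ring
    · simp
    · simp
    · simp
  have hint : ∀ T (j : S × A), Integrable (fun L => ℓskip T L j.1 j.2 ^ 2)
      (Measure.pi fun sa => ν T sa) := by
    intro T j
    have := hν_prob T
    simp_rw [hsq]
    have h1 := integrable_truncation_sq (hτ j.1 j.2) (ν T j)
    exact (((measurePreserving_eval (fun sa => ν T sa) j).integrable_comp_of_integrable
      h1).const_mul _).const_mul _
  have hmom : ∀ j : S × A, ∑ T, p T * ∫ L, ℓskip T L j.1 j.2 ^ 2 ∂(Measure.pi fun sa => ν T sa) ≤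
      K * x j.1 j.2 ^ (-γ) := by
    intro j
    have hpos := hx_pos j.1 j.2
    obtain ⟨B, hB⟩ : ∃ B : ℝ, B = (C * σ * t ^ (1 / α) * x j.1 j.2 ^ (1 / α)) ^ (2 - α) * σ ^ α :=
      ⟨_, rfl⟩
    have hT : ∀ T, p T * ∫ L, ℓskip T L j.1 j.2 ^ 2 ∂(Measure.pi fun sa => ν T sa) ≤
        (if ∃ h, T h = (j.1, j.2) then p T else 0) * ((x j.1 j.2 ^ 2)⁻¹ * B) := by
      intro T
      by_cases hpT : p T = 0
      · simp [hpT]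
      have := hν_prob T
      simp_rw [hsq]
      rw [integral_const_mul, integral_const_mul]
      have h1 : ∫ L : S × A → ℝ, (if |L (j.1, j.2)| ≤ C * σ * t ^ (1 / α) * x j.1 j.2 ^ (1 / α)
          then L (j.1, j.2) else 0) ^ 2 ∂(Measure.pi fun sa => ν T sa) ≤ B := by
        rw [hB]
        refine le_trans (le_of_eq ?_) (integral_truncation_sq_le (hτ j.1 j.2) hα2
          (hν_int T j hpT) (hν_mom T j hpT))
        exact integral_comp_eval (μ := fun sa => ν T sa) (i := j)
          ((measurable_truncation _).pow_const 2).aestronglyMeasurable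
      rw [← mul_assoc, mul_ite, mul_one, mul_zero]
      have h2 : 0 ≤ if ∃ h, T h = (j.1, j.2) then p T else 0 := by
        split_ifs
        · exact hp_nonneg T
        · exact le_rfl
      gcongr
    refine (Finset.sum_le_sum fun T _ => hT T).trans (le_of_eq ?_)
    have h3 := threshold_rpow_mul_eq hσ hC ht0 hpos hα0
    rw [← hK, ← hγ, ← hB] at h3
    rw [← Finset.sum_mul, ← Finset.sum_filter, hp_marg, ← h3]
    field_simp
  have hcs : ∀ T L s a, (Q (ℓskip T L) s a - V (ℓskip T L) s) ^ 2 ≤ H * ∑ j : S × A,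
      (Q (pairIndicator j.1 j.2) s a - V (pairIndicator j.1 j.2) s) ^ 2 *
        ℓskip T L j.1 j.2 ^ 2 := by
    intro T L s a
    have h1 : Q (ℓskip T L) s a - V (ℓskip T L) s = ∑ j : S × A,
        (Q (pairIndicator j.1 j.2) s a - V (pairIndicator j.1 j.2) s) * ℓskip T L j.1 j.2 := by
      rw [(hlin _ s).1 a, (hlin _ s).2, Fintype.sum_prod_type, ← Finset.sum_sub_distrib]
      refine Finset.sum_congr rfl fun s' _ => ?_
      rw [← Finset.sum_sub_distrib]
      refine Finset.sum_congr rfl fun a' _ => ?_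
      ring
    rw [h1]
    simp_rw [← mul_pow]
    refine sq_sum_le_card_mul_of_support T _ fun j hj => ?_
    rw [hℓskip, if_neg hj, mul_zero]
  have hcond : ∀ s a, ∑ j : S × A,
      (Q (pairIndicator j.1 j.2) s a - V (pairIndicator j.1 j.2) s) ^ 2 * x j.1 j.2 ^ (-γ) ≤
      x s a ^ (-γ) * (2 * H * (1 - π s a)) := by
    intro s a
    have hpos := hx0 s a
    calc _ ≤ ∑ j : S × A, x s a ^ (-γ) *
          |Q (pairIndicator j.1 j.2) s a - V (pairIndicator j.1 j.2) s| :=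
          Finset.sum_le_sum fun j _ => sq_mul_rpow_neg_le (hx_pos s a) hγ0 hγ1
            ((hcoef s a).1 j.1 j.2).1 ((hcoef s a).1 j.1 j.2).2
      _ ≤ _ := by
          rw [← Finset.mul_sum, Fintype.sum_prod_type]
          gcongr
          exact (hcoef s a).2
  have hwx : ∀ s a, 0 ≤ x s a ^ (2 - 1 / α) := fun s a => Real.rpow_nonneg (hx0 s a) _
  obtain ⟨W, hW⟩ : ∃ W : S × A → ℝ, ∀ j, W j = c * ∑ s, ∑ a, x s a ^ (2 - 1 / α) *
      (H * (Q (pairIndicator j.1 j.2) s a - V (pairIndicator j.1 j.2) s) ^ 2) :=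
    ⟨_, fun _ => rfl⟩
  have hW0 : ∀ j, 0 ≤ W j := by
    intro j
    rw [hW]
    exact mul_nonneg hc0 (Finset.sum_nonneg fun s _ => Finset.sum_nonneg fun a _ =>
      mul_nonneg (hwx s a) (by positivity))
  have hWsum : ∀ g : S × A → ℝ, ∑ j, W j * g j = c * ∑ s, ∑ a, x s a ^ (2 - 1 / α) *
      (H * ∑ j : S × A,
        (Q (pairIndicator j.1 j.2) s a - V (pairIndicator j.1 j.2) s) ^ 2 * g j) := by
    intro g
    simp_rw [hW, Finset.mul_sum, Finset.sum_mul]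
    rw [Finset.sum_comm]
    refine Finset.sum_congr rfl fun s _ => ?_
    rw [Finset.sum_comm]
    refine Finset.sum_congr rfl fun a _ => Finset.sum_congr rfl fun j _ => ?_
    ring
  have hptw : ∀ T L, c * ∑ s, ∑ a, x s a ^ (2 - 1 / α) *
      (Q (ℓskip T L) s a - V (ℓskip T L) s) ^ 2 ≤ ∑ j, W j * ℓskip T L j.1 j.2 ^ 2 := by
    intro T L
    rw [hWsum]
    exact mul_le_mul_of_nonneg_left (Finset.sum_le_sum fun s _ => Finset.sum_le_sum fun a _ =>
      mul_le_mul_of_nonneg_left (hcs T L s a) (hwx s a)) hc0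
  have hstate : ∀ s, ∑ a, x s a ^ (1 / α) * (1 - π s a) ≤
      2 * ∑ a with a ≠ πd s, x s a ^ (1 / α) := by
    intro s
    have h1 := sum_rpow_mul_one_sub_le (hπ_nonneg s) (hπ_sum s) (X := ∑ b, x s b)
      (Finset.sum_nonneg fun b _ => hx0 s b) (r := 1 / α) (by positivity)
      (by rw [div_le_one hα0]; exact hα1.le) (πd s)
    simp_rw [← hx_pol] at h1
    convert h1
  have hpre : c * K = β * C ^ (2 - α) * σ * t ^ (1 / α - 1) := by
    have e : t ^ (2 / α - 1) = t ^ (1 / α - 1) * t ^ (1 / α) := by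
      rw [← Real.rpow_add ht0]
      congr 1
      ring
    have := Real.rpow_pos_of_pos ht0 (1 / α)
    rw [hc, hK, e]
    field_simp
  obtain ⟨R, hR⟩ : ∃ R : ℝ, R = ∑ s, ∑ a with a ≠ πd s, x s a ^ (1 / α) := ⟨_, rfl⟩
  have hR0 : 0 ≤ R := by
    rw [hR]
    exact Finset.sum_nonneg fun s _ => Finset.sum_nonneg fun a _ => Real.rpow_nonneg (hx0 s a) _
  rw [← hc]
  calc _ ≤ ∑ T, p T * ∫ L, ∑ j, W j * ℓskip T L j.1 j.2 ^ 2 ∂(Measure.pi fun sa => ν T sa) := by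
        refine Finset.sum_le_sum fun T _ => mul_le_mul_of_nonneg_left ?_ (hp_nonneg T)
        refine integral_mono_of_nonneg (Filter.Eventually.of_forall fun L => ?_)
          (integrable_finsetSum _ fun j _ => (hint T j).const_mul _)
          (Filter.Eventually.of_forall fun L => hptw T L)
        exact mul_nonneg hc0 (Finset.sum_nonneg fun s _ => Finset.sum_nonneg fun a _ =>
          mul_nonneg (hwx s a) (sq_nonneg _))
    _ = ∑ j, W j * ∑ T, p T * ∫ L, ℓskip T L j.1 j.2 ^ 2 ∂(Measure.pi fun sa => ν T sa) :=
        sum_mul_integral_sum p _ W (fun T j L => ℓskip T L j.1 j.2 ^ 2) hint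
    _ ≤ ∑ j, W j * (K * x j.1 j.2 ^ (-γ)) :=
        Finset.sum_le_sum fun j _ => mul_le_mul_of_nonneg_left (hmom j) (hW0 j)
    _ = K * ∑ j, W j * x j.1 j.2 ^ (-γ) := by
        rw [Finset.mul_sum]
        refine Finset.sum_congr rfl fun j _ => ?_
        ring
    _ ≤ K * (c * ∑ s, ∑ a, x s a ^ (2 - 1 / α) *
          (H * (x s a ^ (-γ) * (2 * H * (1 - π s a))))) := by
        rw [hWsum fun j => x j.1 j.2 ^ (-γ)]
        refine mul_le_mul_of_nonneg_left (mul_le_mul_of_nonneg_left (Finset.sum_le_sum fun s _ =>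
          Finset.sum_le_sum fun a _ => mul_le_mul_of_nonneg_left
            (mul_le_mul_of_nonneg_left (hcond s a) (Nat.cast_nonneg H)) (hwx s a)) hc0) hK0
    _ = 2 * H ^ 2 * (c * K) * ∑ s, ∑ a, x s a ^ (1 / α) * (1 - π s a) := by
        simp_rw [Finset.mul_sum]
        refine Finset.sum_congr rfl fun s _ => Finset.sum_congr rfl fun a _ => ?_
        have e : x s a ^ (1 / α) = x s a ^ (2 - 1 / α) * x s a ^ (-γ) := by
          rw [← Real.rpow_add (hx_pos s a), hγ]
          congr 1
          ring
        rw [e]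
        ring
    _ ≤ 2 * H ^ 2 * (c * K) * (2 * R) := by
        refine mul_le_mul_of_nonneg_left ?_ (by positivity)
        rw [hR, Finset.mul_sum]
        exact Finset.sum_le_sum fun s _ => hstate s
    _ ≤ 8 * H ^ 2 * (c * K) * R := by
        have : 0 ≤ (H : ℝ) ^ 2 * (c * K) * R := by positivity
        linarith
    _ = _ := by
        rw [hpre, hR]
        ring
end

section
/- Cumulative stability contribution of the skipping bonus: for each t ∈ {1,…,T}, let x_t = ρ^{ℙ,π_t} be the occupancy measure of a policy π_t with strictly positive entries, let η_t = β/(σ t^{1/α}), b_t^{skip}(s,a) = C^{1−α} σ t^{1/α − 1} x_t(s,a)^{1/α − 1}, and bonus_t := η_t ∑_{(s,a)} x_t(s,a)^{2 − 1/α} (b_t^{skip}(s,a))². Then for all T ≥ 3, ∑_{t=1}^T bonus_t ≤ 2 S A^{1 − 1/α} β C^{2 − 2α} · σ · log T. -/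
open Finset MeasureTheory

open scoped Classical

theorem sum_layer_occupancy_le_one {S A : Type*} [Fintype S] [Fintype A]
    {H : ℕ} {layer : S → ℕ} (hlayer : ∀ s, layer s ≤ H)
    {s1 : S} (hs1 : ∀ s, layer s = 1 ↔ s = s1)
    {P : S → A → S → ℝ} (hP_nonneg : ∀ s a s', 0 ≤ P s a s')
    (hP_supp : ∀ s a s', P s a s' ≠ 0 → layer s' = layer s + 1)
    (hP_sum : ∀ s a, layer s < H → ∑ s', P s a s' = 1)
    {pol x : S → A → ℝ} (hpol_sum : ∀ s, ∑ a, pol s a = 1)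
    (hx_nonneg : ∀ s a, 0 ≤ x s a) (hx_init : ∀ a, x s1 a = pol s1 a)
    (hx_rec : ∀ s' a', 2 ≤ layer s' →
      x s' a' = pol s' a' * ∑ s, ∑ a, P s a s' * x s a)
    {h : ℕ} (hh : 1 ≤ h) :
    ∑ s, (if layer s = h then ∑ a, x s a else 0) ≤ 1 := by
  induction h, hh using Nat.le_induction with
  | base =>
    simp only [hs1, Finset.sum_ite_eq', Finset.mem_univ, if_true, hx_init, hpol_sum, le_refl]
  | succ h hh ih =>
    calc ∑ s', (if layer s' = h + 1 then ∑ a, x s' a else 0)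
        = ∑ s', ∑ s, ∑ a, (if layer s' = h + 1 then P s a s' * x s a else 0) := by
          refine Finset.sum_congr rfl fun s' _ => ?_
          split_ifs with hs'
          · rw [Finset.sum_congr rfl fun a _ => hx_rec s' a (by omega), ← Finset.sum_mul,
              hpol_sum, one_mul]
          · simp
      _ = ∑ s, ∑ a, (∑ s', if layer s' = h + 1 then P s a s' else 0) * x s a := by
          rw [Finset.sum_comm]
          refine Finset.sum_congr rfl fun s _ => ?_
          rw [Finset.sum_comm]
          refine Finset.sum_congr rfl fun a _ => ?_
          rw [Finset.sum_mul]
          exact Finset.sum_congr rfl fun s' _ => by rw [ite_mul, zero_mul]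
      _ ≤ ∑ s, ∑ a, (if layer s = h then x s a else 0) := by
          refine Finset.sum_le_sum fun s _ => Finset.sum_le_sum fun a _ => ?_
          split_ifs with hs
          · refine mul_le_of_le_one_left (hx_nonneg s a) ?_
            by_cases hH : h < H
            · rw [← hP_sum s a (hs ▸ hH)]
              refine Finset.sum_le_sum fun s' _ => ?_
              split_ifs
              · exact le_rfl
              · exact hP_nonneg s a s'
            · refine (Finset.sum_nonpos fun s' _ => ?_).trans zero_le_one
              rw [if_neg]
              have := hlayer s'
              omega
          · rw [Finset.sum_eq_zero, zero_mul]
            intro s' _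
            split_ifs with hs'
            · by_contra hne
              have := hP_supp s a s' hne
              omega
            · rfl
      _ = ∑ s, (if layer s = h then ∑ a, x s a else 0) := by
          refine Finset.sum_congr rfl fun s _ => ?_
          split_ifs <;> simp
      _ ≤ 1 := ih

theorem sum_rpow_inv_le_card_rpow {ι : Type*} [Fintype ι] {f : ι → ℝ} {α : ℝ} (hα : 1 ≤ α)
    (hf : ∀ i, 0 ≤ f i) (hsum : ∑ i, f i ≤ 1) :
    ∑ i, f i ^ (1 / α) ≤ (Fintype.card ι : ℝ) ^ (1 - 1 / α) := by
  have hα0 : 0 < α := by linarith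
  have hnn : ∀ i, 0 ≤ f i ^ (1 / α) := fun i => Real.rpow_nonneg (hf i) _
  have key := Real.rpow_sum_le_const_mul_sum_rpow Finset.univ (fun i => f i ^ (1 / α)) hα
  have hpow : ∀ i, (f i ^ (1 / α)) ^ α = f i := fun i => by
    rw [← Real.rpow_mul (hf i), one_div_mul_cancel hα0.ne', Real.rpow_one]
  simp only [abs_of_nonneg (hnn _), hpow, Finset.card_univ] at key
  have hcard : (0 : ℝ) ≤ Fintype.card ι := Nat.cast_nonneg _
  rw [← Real.rpow_le_rpow_iff (Finset.sum_nonneg fun i _ => hnn i) (Real.rpow_nonneg hcard _) hα0,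
    ← Real.rpow_mul hcard, sub_mul, one_mul, one_div_mul_cancel hα0.ne']
  exact key.trans (mul_le_of_le_one_right (Real.rpow_nonneg hcard _) hsum)

theorem sum_Icc_inv_le_two_mul_log {T : ℕ} (hT : 3 ≤ T) :
    ∑ t ∈ Finset.Icc 1 T, (t : ℝ)⁻¹ ≤ 2 * Real.log T := by
  have h := harmonic_le_one_add_log T
  rw [harmonic_eq_sum_Icc] at h
  push_cast at h
  have hlog : 1 ≤ Real.log T := by
    rw [Real.le_log_iff_exp_le (by positivity)]
    have : (3 : ℝ) ≤ T := by exact_mod_cast hT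
    linarith [Real.exp_one_lt_three]
  linarith

theorem bonus_summand_eq {α σ C t y : ℝ} (hC : 0 < C) (ht : 0 < t) (hy : 0 < y) :
    y ^ (2 - 1 / α) * (C ^ (1 - α) * σ * t ^ (1 / α - 1) * y ^ (1 / α - 1)) ^ 2
      = C ^ (2 - 2 * α) * σ ^ 2 * t ^ (2 / α - 2) * y ^ (1 / α) := by
  have hsq : ∀ {u : ℝ}, 0 < u → ∀ e : ℝ, (u ^ e) ^ 2 = u ^ (e * 2) := fun {u} hu e => by
    rw [← Real.rpow_mul_natCast hu.le]
    norm_num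
  have hy' : y ^ (2 - 1 / α) * y ^ ((1 / α - 1) * 2) = y ^ (1 / α) := by
    rw [← Real.rpow_add hy]
    ring_nf
  rw [mul_pow, mul_pow, mul_pow, hsq hC, hsq ht, hsq hy, ← hy',
    show (1 - α) * 2 = 2 - 2 * α by ring, show (1 / α - 1) * 2 = 2 / α - 2 by ring]
  ring

theorem stmt_14
    {S A : Type*} [Fintype S] [Fintype A] [Nonempty S] [Nonempty A]
    [DecidableEq S] [DecidableEq A]
    (H : ℕ) (hH : 1 ≤ H)
    (layer : S → ℕ)
    (hlayer : ∀ s : S, 1 ≤ layer s ∧ layer s ≤ H)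
    (hlayer_ne : ∀ h : ℕ, 1 ≤ h → h ≤ H → ∃ s : S, layer s = h)
    (s1 : S) (hs1 : ∀ s : S, (layer s = 1 ↔ s = s1))
    (P : S → A → S → ℝ)
    (hP_nonneg : ∀ s a s', 0 ≤ P s a s')
    (hP_supp : ∀ s a s', P s a s' ≠ 0 → layer s' = layer s + 1)
    (hP_sum : ∀ s a, layer s < H → ∑ s', P s a s' = 1)
    (α σ β C : ℝ)
    (hα1 : 1 < α) (hα2 : α ≤ 2) (hσ : 0 < σ) (hβ : 0 < β) (hC : 0 < C)
    (T : ℕ) (hT : 3 ≤ T)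
    (pol : ℕ → S → A → ℝ)
    (hpol_nonneg : ∀ t ∈ Finset.Icc 1 T, ∀ s a, 0 ≤ pol t s a)
    (hpol_sum : ∀ t ∈ Finset.Icc 1 T, ∀ s, ∑ a, pol t s a = 1)
    (x : ℕ → S → A → ℝ)
    (hx_pos : ∀ t ∈ Finset.Icc 1 T, ∀ s a, 0 < x t s a)
    (hx_init : ∀ t ∈ Finset.Icc 1 T, ∀ a, x t s1 a = pol t s1 a)
    (hx_rec : ∀ t ∈ Finset.Icc 1 T, ∀ s' a', 2 ≤ layer s' →
      x t s' a' = pol t s' a' * ∑ s, ∑ a, P s a s' * x t s a) :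
    ∑ t ∈ Finset.Icc 1 T,
        (β / (σ * (t : ℝ) ^ (1/α))) *
          ∑ s, ∑ a, x t s a ^ (2 - 1/α) *
            (C ^ (1 - α) * σ * (t : ℝ) ^ (1/α - 1) * x t s a ^ (1/α - 1)) ^ 2
      ≤ 2 * (Fintype.card S : ℝ) * (Fintype.card A : ℝ) ^ (1 - 1/α) * β * C ^ (2 - 2 * α) * σ *
          Real.log T := by
  have hα0 : 0 < α := by linarith
  set K : ℝ := (Fintype.card S : ℝ) * (Fintype.card A : ℝ) ^ (1 - 1 / α) with hK
  have hK0 : 0 ≤ K := by positivity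
  have hstate : ∀ t ∈ Finset.Icc 1 T, ∀ s, ∑ a, x t s a ≤ 1 := by
    intro t ht s
    have hx0 : ∀ s a, 0 ≤ x t s a := fun s a => (hx_pos t ht s a).le
    refine le_trans ?_ (sum_layer_occupancy_le_one (fun s => (hlayer s).2) hs1 hP_nonneg hP_supp
      hP_sum (hpol_sum t ht) hx0 (hx_init t ht) (hx_rec t ht) (hlayer s).1)
    refine le_trans (by rw [if_pos rfl]) (Finset.single_le_sum
      (f := fun s' => if layer s' = layer s then ∑ a, x t s' a else 0) (fun s' _ => ?_)
      (Finset.mem_univ s))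
    split_ifs
    · exact Finset.sum_nonneg fun a _ => hx0 s' a
    · exact le_rfl
  have hsum : ∀ t ∈ Finset.Icc 1 T, ∑ s, ∑ a, x t s a ^ (1 / α) ≤ K := by
    intro t ht
    calc ∑ s, ∑ a, x t s a ^ (1 / α)
        ≤ ∑ _s : S, (Fintype.card A : ℝ) ^ (1 - 1 / α) := Finset.sum_le_sum fun s _ =>
          sum_rpow_inv_le_card_rpow hα1.le (fun a => (hx_pos t ht s a).le) (hstate t ht s)
      _ = K := by rw [Finset.sum_const, Finset.card_univ, nsmul_eq_mul]
  have hbonus : ∀ t ∈ Finset.Icc 1 T,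
      (β / (σ * (t : ℝ) ^ (1 / α))) * ∑ s, ∑ a, x t s a ^ (2 - 1 / α) *
        (C ^ (1 - α) * σ * (t : ℝ) ^ (1 / α - 1) * x t s a ^ (1 / α - 1)) ^ 2
      ≤ β * C ^ (2 - 2 * α) * σ * K * (t : ℝ)⁻¹ := by
    intro t ht
    have ht1 : (1 : ℝ) ≤ t := by exact_mod_cast (Finset.mem_Icc.mp ht).1
    have ht0 : (0 : ℝ) < t := by linarith
    simp only [bonus_summand_eq hC ht0 (hx_pos t ht _ _), ← Finset.mul_sum]
    have htpow : (t : ℝ) ^ (2 / α - 2) / (t : ℝ) ^ (1 / α) ≤ (t : ℝ)⁻¹ := by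
      rw [← Real.rpow_sub ht0, ← Real.rpow_neg_one]
      refine Real.rpow_le_rpow_of_exponent_le ht1 ?_
      have h1 : 1 / α ≤ 1 := (div_le_one hα0).2 hα1.le
      have h2 : 2 / α = 2 * (1 / α) := by ring
      linarith
    calc _ = β * C ^ (2 - 2 * α) * σ * (∑ s, ∑ a, x t s a ^ (1 / α)) *
          ((t : ℝ) ^ (2 / α - 2) / (t : ℝ) ^ (1 / α)) := by
          field_simp
      _ ≤ β * C ^ (2 - 2 * α) * σ * K * (t : ℝ)⁻¹ := by
          gcongr
          exact hsum t ht
  calc _ ≤ ∑ t ∈ Finset.Icc 1 T, β * C ^ (2 - 2 * α) * σ * K * (t : ℝ)⁻¹ :=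
        Finset.sum_le_sum hbonus
    _ = β * C ^ (2 - 2 * α) * σ * K * ∑ t ∈ Finset.Icc 1 T, (t : ℝ)⁻¹ := by
        rw [Finset.mul_sum]
    _ ≤ β * C ^ (2 - 2 * α) * σ * K * (2 * Real.log T) := by
        gcongr
        exact sum_Icc_inv_le_two_mul_log hT
    _ = _ := by
        rw [hK]
        ring
end

section
/- Self-bounding balancing lemma: let α ∈ (1,2] and let R, κ, Λ, C ≥ 0 be reals such that for every γ ∈ (0,1), R ≤ γR + γC + κ + γ^{−1/(α−1)} Λ. Then R ≤ 2κ + 2^{1 + α/(α−1)} Λ + 4 C^{1/α} Λ^{(α−1)/α}. -/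
open Finset MeasureTheory

open scoped Classical

/-- If `R ≤ γ * (R + C) + κ` for all `γ ∈ (0, 1)`, then letting `γ → 0` gives `R ≤ κ`. -/
theorem le_of_forall_le_mul_add {R κ C : ℝ} (hκ : 0 ≤ κ) (hC : 0 ≤ C)
    (h : ∀ γ : ℝ, 0 < γ → γ < 1 → R ≤ γ * R + γ * C + κ) : R ≤ κ := by
  by_contra! hlt
  have hD : 0 < 2 * (R + C + (R - κ)) := by linarith
  have hγ : 0 < (R - κ) / (2 * (R + C + (R - κ))) := div_pos (by linarith) hD
  have hmul := div_mul_cancel₀ (R - κ) hD.ne'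
  have hle := h _ hγ (by rw [div_lt_one hD]; linarith)
  nlinarith

theorem stmt_17
    (α R κ Λ C : ℝ) (hα1 : 1 < α) (hα2 : α ≤ 2)
    (hR : 0 ≤ R) (hκ : 0 ≤ κ) (hΛ : 0 ≤ Λ) (hC : 0 ≤ C)
    (h : ∀ γ : ℝ, 0 < γ → γ < 1 → R ≤ γ * R + γ * C + κ + γ ^ (-(1/(α - 1))) * Λ) :
    R ≤ 2 * κ + (2 : ℝ) ^ (1 + α/(α - 1)) * Λ + 4 * C ^ (1/α) * Λ ^ ((α - 1)/α) := by
  have hα0 : 0 < α := by linarith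
  have hα1' : 0 < α - 1 := by linarith
  have hpow : (2 : ℝ) ^ (1 + α/(α - 1)) = 2 * 2 ^ (α/(α - 1)) := by
    rw [Real.rpow_add two_pos, Real.rpow_one]
  have hlast : 0 ≤ C ^ (1/α) * Λ ^ ((α - 1)/α) := by positivity
  have hmid : 0 ≤ (2 : ℝ) ^ (α/(α - 1)) * Λ := by positivity
  rw [hpow]
  rcases le_or_gt C (2 ^ (α/(α - 1)) * Λ) with hCle | hClt
  · have hhalf := h (1/2) (by norm_num) (by norm_num)
    have hexp : (2 : ℝ) ^ (α/(α - 1)) = 2 * (1/2 : ℝ) ^ (-(1/(α - 1))) := by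
      rw [one_div (2 : ℝ), Real.inv_rpow zero_le_two, Real.rpow_neg zero_le_two, inv_inv,
        show α/(α - 1) = 1 + 1/(α - 1) by field_simp; ring, Real.rpow_add two_pos, Real.rpow_one]
    rw [hexp] at hCle ⊢
    linarith
  · rcases hΛ.eq_or_lt with rfl | hΛpos
    · have := le_of_forall_le_mul_add hκ hC (by simpa using h)
      linarith
    · have hCpos : 0 < C := hmid.trans_lt hClt
      have hratio : 0 < Λ / C := div_pos hΛpos hCpos
      have hγle : (Λ / C) ^ ((α - 1)/α) ≤ 1/2 := by
        have hle : Λ / C ≤ (1/2 : ℝ) ^ (α/(α - 1)) := by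
          rw [one_div, Real.inv_rpow zero_le_two, div_le_iff₀ hCpos, inv_mul_eq_div,
            le_div_iff₀ (by positivity)]
          linarith
        calc (Λ / C) ^ ((α - 1)/α) ≤ ((1/2 : ℝ) ^ (α/(α - 1))) ^ ((α - 1)/α) :=
              Real.rpow_le_rpow hratio.le hle (by positivity)
          _ = 1/2 := by
              rw [← Real.rpow_mul (by norm_num),
                show α/(α - 1) * ((α - 1)/α) = 1 by field_simp, Real.rpow_one]
      have hfirst : (Λ / C) ^ ((α - 1)/α) * C = C ^ (1/α) * Λ ^ ((α - 1)/α) := by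
        have hsplit : C = C ^ (1/α) * C ^ ((α - 1)/α) := by
          rw [← Real.rpow_add hCpos, show 1/α + (α - 1)/α = 1 by field_simp; ring, Real.rpow_one]
        rw [Real.div_rpow hΛ hC, div_mul_eq_mul_div, div_eq_iff (by positivity)]
        nth_rewrite 1 [hsplit]
        ring
      have hsecond : ((Λ / C) ^ ((α - 1)/α)) ^ (-(1/(α - 1))) * Λ =
          C ^ (1/α) * Λ ^ ((α - 1)/α) := by
        have hsplit : Λ = Λ ^ (1/α) * Λ ^ ((α - 1)/α) := by
          rw [← Real.rpow_add hΛpos, show 1/α + (α - 1)/α = 1 by field_simp; ring, Real.rpow_one]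
        rw [← Real.rpow_mul hratio.le,
          show (α - 1)/α * (-(1/(α - 1))) = -(1/α) by field_simp,
          Real.rpow_neg hratio.le, Real.div_rpow hΛ hC, inv_div, div_mul_eq_mul_div,
          div_eq_iff (by positivity)]
        nth_rewrite 1 [hsplit]
        ring
      have hbal := h _ (Real.rpow_pos_of_pos hratio ((α - 1)/α)) (by linarith)
      rw [hfirst, hsecond] at hbal
      have hγR := mul_le_mul_of_nonneg_right hγle hR
      linarith
end
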